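/- arXiv:1307.5817 — 2 statements merged into one kernel-verified Lean document; each statement's English description precedes it below -/
import Mathlib

section
/- Let 1 < p_k ≤ H < ∞ for all k. An infinite matrix A = (a_{nk}) maps l(p) into l_1 if and only if there exists an integer L ≥ 1 such that sup_F Σ_k |Σ_{n∈F} a_{nk} L^{-1}|^{p_k'} < ∞, where the supremum is over all nonempty finite subsets F of ℕ₀ and p_k' = p_k/(p_k−1). -/
open Filter Finset Topology

namespace GE

lemma summable_norm_l1 {J : Type} (c : lp (fun _ : J => ℂ) 1) : Summable fun j => ‖c j‖ := by
  have := (lp.memℓp c).summable (by norm_num)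
  simpa using this

lemma summable_mul_bdd {J : Type} {c : J → ℂ} (hc : Summable fun j => ‖c j‖) {f : J → ℂ} {M : ℝ}
    (hf : ∀ j, ‖f j‖ ≤ M) : Summable fun j => c j * f j := by
  refine Summable.of_norm_bounded (hc.mul_right M) fun j => ?_
  rw [norm_mul]
  exact mul_le_mul_of_nonneg_left (hf j) (norm_nonneg _)

/-- Uniform boundedness on atoms. -/
lemma ub {J ι : Type} (φ : ι → J → ℂ) (hb : ∀ i, ∃ M, ∀ j, ‖φ i j‖ ≤ M)
    (hpt : ∀ c : J → ℂ, (Summable fun j => ‖c j‖) → ∃ M, ∀ i, ‖∑' j, c j * φ i j‖ ≤ M) :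
    ∃ M, ∀ i j, ‖φ i j‖ ≤ M := by
  classical
  choose M hM using hb
  let T : ι → (lp (fun _ : J => ℂ) 1 →L[ℂ] ℂ) := fun i =>
    LinearMap.mkContinuous
      { toFun := fun c => ∑' j, c j * φ i j
        map_add' := fun c d => by
          rw [← Summable.tsum_add (summable_mul_bdd (summable_norm_l1 c) (hM i))
            (summable_mul_bdd (summable_norm_l1 d) (hM i))]
          congr 1; ext j; simp [add_mul]
        map_smul' := fun a c => by
          simp only [lp.coeFn_smul, Pi.smul_apply, smul_eq_mul, RingHom.id_apply]
          rw [← tsum_mul_left]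
          congr 1; ext j; ring } (M i) (fun c => by
        have hs := summable_norm_l1 c
        have hn : ‖c‖ = ∑' j, ‖c j‖ := by
          have := lp.norm_eq_tsum_rpow (p := 1) (by norm_num) c
          simpa using this
        rw [hn, ← tsum_mul_left]
        refine tsum_of_norm_bounded (hs.mul_left (M i)).hasSum fun j => ?_
        rw [norm_mul, mul_comm]
        exact mul_le_mul_of_nonneg_right (hM i j) (norm_nonneg _))
  have hT : ∀ i c, T i c = ∑' j, c j * φ i j := fun i c => rfl
  obtain ⟨C, hC⟩ := banach_steinhaus (g := T) (fun c => by
    obtain ⟨K, hK⟩ := hpt c (summable_norm_l1 c)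
    exact ⟨K, fun i => by rw [hT]; exact hK i⟩)
  refine ⟨C, fun i j => ?_⟩
  have h1 := (T i).le_of_opNorm_le (hC i) (lp.single 1 j (1 : ℂ))
  rw [lp.norm_single (by norm_num), hT, tsum_eq_single j] at h1
  · simpa using h1
  · intro k hk
    simp [lp.single_apply, Pi.single_apply, hk]

/-- The modular unit ball. -/
def K (p : ℕ → ℝ) : Type := {z : ℕ → ℂ // ∀ m, ∑ k ∈ range m, ‖z k‖ ^ p k ≤ 1}

lemma K_le {p : ℕ → ℝ} (hp : ∀ k, 1 < p k) (z : K p) (k : ℕ) : ‖z.1 k‖ ≤ 1 := by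
  have h1 : ‖z.1 k‖ ^ p k ≤ 1 :=
    (single_le_sum (f := fun k => ‖z.1 k‖ ^ p k) (fun i _ => by positivity)
      (self_mem_range_succ k)).trans (z.2 (k+1))
  by_contra h
  push Not at h
  exact absurd (Real.one_lt_rpow h (by linarith [hp k])) (not_lt.2 h1)

lemma comb_mem {p : ℕ → ℝ} {H : ℝ} (hp : ∀ k, 1 < p k) (hpH : ∀ k, p k ≤ H)
    (c : K p → ℂ) (hc : Summable fun j => ‖c j‖) :
    Summable fun k => ‖∑' j, c j * j.1 k‖ ^ p k := by
  set S : ℝ := 1 + ∑' j, ‖c j‖ with hS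
  have hS1 : 1 ≤ S := by
    have : 0 ≤ ∑' j, ‖c j‖ := tsum_nonneg (fun j => norm_nonneg (c j))
    linarith
  refine summable_of_sum_range_le (c := S ^ H * S) (fun k => by positivity) fun m => ?_
  have ht : Tendsto (fun s : Finset (K p) => ∑ k ∈ range m, ‖∑ j ∈ s, c j * j.1 k‖ ^ p k) atTop
      (nhds (∑ k ∈ range m, ‖∑' j, c j * j.1 k‖ ^ p k)) := by
    refine tendsto_finsetSum _ fun k _ => ?_
    have h := (summable_mul_bdd hc (fun j => K_le hp j k)).hasSum
    exact (Tendsto.norm h).rpow_const (Or.inr (by linarith [hp k]))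
  refine le_of_tendsto' ht fun s => ?_
  have hw : ∑ j ∈ s, ‖c j‖ ≤ S := by
    have := hc.sum_le_tsum s (fun j _ => norm_nonneg (c j)); linarith
  have key : ∀ k, ‖∑ j ∈ s, c j * j.1 k‖ ^ p k ≤ S ^ H * ∑ j ∈ s, ‖c j‖ * ‖j.1 k‖ ^ p k := by
    intro k
    have hp0 : 0 < p k := by linarith [hp k]
    have h0 : ‖∑ j ∈ s, c j * j.1 k‖ ≤ ∑ j ∈ s, ‖c j‖ * ‖j.1 k‖ :=
      (norm_sum_le _ _).trans (by simp)
    have h1 := Real.inner_le_weight_mul_Lp_of_nonneg s (hp k).le (fun j => ‖c j‖)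
      (fun j => ‖j.1 k‖) (fun _ => norm_nonneg _) (fun _ => norm_nonneg _)
    have hB : 0 ≤ ∑ j ∈ s, ‖c j‖ * ‖j.1 k‖ ^ p k := sum_nonneg fun _ _ => by positivity
    have hA : 0 ≤ ∑ j ∈ s, ‖c j‖ := sum_nonneg fun _ _ => by positivity
    calc _ ≤ ((∑ j ∈ s, ‖c j‖) ^ (1 - (p k)⁻¹) * (∑ j ∈ s, ‖c j‖ * ‖j.1 k‖ ^ p k) ^ (p k)⁻¹) ^ p k :=
          Real.rpow_le_rpow (norm_nonneg _) (h0.trans h1) hp0.le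
      _ = (∑ j ∈ s, ‖c j‖) ^ (p k - 1) * ∑ j ∈ s, ‖c j‖ * ‖j.1 k‖ ^ p k := by
          rw [Real.mul_rpow (by positivity) (by positivity), ← Real.rpow_mul hA,
            ← Real.rpow_mul hB, inv_mul_cancel₀ hp0.ne', Real.rpow_one]
          congr 2; field_simp
      _ ≤ _ := by
          refine mul_le_mul_of_nonneg_right ?_ hB
          exact (Real.rpow_le_rpow hA hw (by linarith [hp k])).trans
            (Real.rpow_le_rpow_of_exponent_le hS1 (by linarith [hpH k]))
  calc _ ≤ ∑ k ∈ range m, S ^ H * ∑ j ∈ s, ‖c j‖ * ‖j.1 k‖ ^ p k := sum_le_sum fun k _ => key k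
    _ = S ^ H * ∑ j ∈ s, ‖c j‖ * ∑ k ∈ range m, ‖j.1 k‖ ^ p k := by
        rw [← mul_sum, sum_comm]; simp_rw [mul_sum]
    _ ≤ S ^ H * ∑ j ∈ s, ‖c j‖ * 1 := by
        gcongr with j hj
        exact j.2 m
    _ ≤ S ^ H * S := by simpa using mul_le_mul_of_nonneg_left hw (by positivity)

lemma forward (p : ℕ → ℝ) (H : ℝ) (hp : ∀ k, 1 < p k) (hpH : ∀ k, p k ≤ H)
    (A : ℕ → ℕ → ℂ)
    (h : ∀ x : ℕ → ℂ, (Summable fun k => ‖x k‖ ^ p k) →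
      ∃ Ax : ℕ → ℂ,
        (∀ n, Tendsto (fun m => ∑ k ∈ Finset.range m, A n k * x k) atTop (nhds (Ax n))) ∧
        Summable fun n => ‖Ax n‖) :
    ∃ T : ℕ → K p → ℂ, (∀ n z, Tendsto (fun m => ∑ k ∈ Finset.range m, A n k * z.1 k) atTop
      (nhds (T n z))) ∧ ∃ M : ℝ, ∀ (F : Finset ℕ) z, ‖∑ n ∈ F, T n z‖ ≤ M := by
  have hmem : ∀ z : K p, Summable fun k => ‖z.1 k‖ ^ p k := fun z =>
    summable_of_sum_range_le (fun k => by positivity) z.2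
  choose T0 hT0 _ using fun z : K p => h z.1 (hmem z)
  have swap : ∀ n m (c : K p → ℂ), (Summable fun j => ‖c j‖) →
      ∑' j, c j * ∑ k ∈ range m, A n k * j.1 k = ∑ k ∈ range m, A n k * ∑' j, c j * j.1 k := by
    intro n m c hc
    simp_rw [mul_sum, ← tsum_mul_left]
    rw [Summable.tsum_finsetSum]
    · refine sum_congr rfl fun k _ => tsum_congr fun j => by ring
    · intro k _
      refine ((summable_mul_bdd hc (fun j => K_le hp j k)).mul_left (A n k)).congr fun j => by ring
  have step1 : ∀ n, ∃ M, ∀ m (z : K p), ‖∑ k ∈ range m, A n k * z.1 k‖ ≤ M := by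
    intro n
    refine ub (fun m (z : K p) => ∑ k ∈ range m, A n k * z.1 k) (fun m => ?_) fun c hc => ?_
    · refine ⟨∑ k ∈ range m, ‖A n k‖, fun z => (norm_sum_le _ _).trans (sum_le_sum fun k _ => ?_)⟩
      rw [norm_mul]
      exact mul_le_of_le_one_right (norm_nonneg _) (K_le hp z k)
    · obtain ⟨Ax, hAx, -⟩ := h _ (comb_mem hp hpH c hc)
      obtain ⟨M, hM⟩ := (hAx n).norm.bddAbove_range
      refine ⟨M, fun m => ?_⟩
      rw [swap n m c hc]
      exact hM ⟨m, rfl⟩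
  choose M hM using step1
  have hTM : ∀ n z, ‖T0 z n‖ ≤ M n := fun n z =>
    le_of_tendsto' (hT0 z n).norm fun m => hM n m z
  refine ⟨fun n z => T0 z n, fun n z => hT0 z n, ?_⟩
  refine ub (fun (F : Finset ℕ) (z : K p) => ∑ n ∈ F, T0 z n) (fun F => ?_) fun c hc => ?_
  · exact ⟨∑ n ∈ F, M n, fun z => (norm_sum_le _ _).trans (sum_le_sum fun n _ => hTM n z)⟩
  · obtain ⟨Ax, hAx, hs⟩ := h _ (comb_mem hp hpH c hc)
    have hid : ∀ n, ∑' j, c j * T0 j n = Ax n := by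
      intro n
      refine tendsto_nhds_unique ?_ (hAx n)
      simp_rw [← swap n _ c hc]
      refine tendsto_tsum_of_dominated_convergence (bound := fun j => ‖c j‖ * M n)
        (hc.mul_right _) (fun j => (hT0 j n).const_mul _) (Eventually.of_forall fun m j => ?_)
      rw [norm_mul]
      exact mul_le_mul_of_nonneg_left (hM n m j) (norm_nonneg _)
    refine ⟨∑' n, ‖Ax n‖, fun F => ?_⟩
    have : ∑' j, c j * ∑ n ∈ F, T0 j n = ∑ n ∈ F, Ax n := by
      simp_rw [mul_sum]
      rw [Summable.tsum_finsetSum fun n _ => summable_mul_bdd hc (hTM n)]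
      exact sum_congr rfl fun n _ => hid n
    rw [this]
    exact (norm_sum_le _ _).trans (hs.sum_le_tsum F fun _ _ => norm_nonneg _)

lemma test (p : ℕ → ℝ) (hp : ∀ k, 1 < p k) (β : ℕ → ℂ) (m : ℕ)
    (hS : 1 < ∑ k ∈ range m, ‖β k‖ ^ (p k / (p k - 1))) :
    ∃ z : K p, (∀ k, m ≤ k → z.1 k = 0) ∧ ∑ k ∈ range m, β k * z.1 k = 1 := by
  set S := ∑ k ∈ range m, ‖β k‖ ^ (p k / (p k - 1)) with hSd
  have hS0 : 0 < S := by linarith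
  let z : ℕ → ℂ := fun k => if k < m then
    (starRingEnd ℂ (β k) / (‖β k‖ : ℂ)) * ((‖β k‖ ^ (p k / (p k - 1) - 1) / S : ℝ) : ℂ) else 0
  have hq : ∀ k, 0 < p k / (p k - 1) - 1 := fun k => by
    have : 0 < p k - 1 := by linarith [hp k]
    rw [div_sub_one this.ne']; apply div_pos <;> linarith
  have hzn : ∀ k, ‖z k‖ ^ p k ≤ if k < m then ‖β k‖ ^ (p k / (p k - 1)) / S else 0 := by
    intro k
    have hp0 : 0 < p k := by linarith [hp k]
    have hp1 : p k - 1 ≠ 0 := by linarith [hp k]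
    by_cases hk : k < m
    · simp only [z, hk, if_true]
      have h1 : ‖(starRingEnd ℂ (β k) / (‖β k‖ : ℂ)) *
          ((‖β k‖ ^ (p k / (p k - 1) - 1) / S : ℝ) : ℂ)‖ ≤ ‖β k‖ ^ (p k / (p k - 1) - 1) / S := by
        rw [norm_mul, norm_div, Complex.norm_real, Complex.norm_real, RCLike.norm_conj, norm_norm,
          Real.norm_of_nonneg (by positivity)]
        exact mul_le_of_le_one_left (by positivity) (div_self_le_one _)
      refine (Real.rpow_le_rpow (norm_nonneg _) h1 hp0.le).trans ?_
      rw [Real.div_rpow (by positivity) hS0.le, ← Real.rpow_mul (norm_nonneg _)]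
      have e : (p k / (p k - 1) - 1) * p k = p k / (p k - 1) := by field_simp; ring
      rw [e]
      have : S ≤ S ^ p k := Real.self_le_rpow_of_one_le hS.le (hp k).le
      gcongr
    · simp [z, hk, hp0.ne']
  refine ⟨⟨z, fun n => ?_⟩, fun k hk => by simp [z, not_lt.2 hk], ?_⟩
  · calc _ ≤ ∑ k ∈ range n, if k < m then ‖β k‖ ^ (p k / (p k - 1)) / S else 0 :=
          sum_le_sum fun k _ => hzn k
      _ = ∑ k ∈ (range n).filter (· < m), ‖β k‖ ^ (p k / (p k - 1)) / S := by rw [sum_filter]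
      _ ≤ ∑ k ∈ range m, ‖β k‖ ^ (p k / (p k - 1)) / S := by
          refine sum_le_sum_of_subset_of_nonneg (fun k hk => ?_) fun _ _ _ => by positivity
          simp at hk ⊢; exact hk.2
      _ = 1 := by rw [← sum_div]; exact div_self hS0.ne'
  · have : ∀ k ∈ range m, β k * z k = ((‖β k‖ ^ (p k / (p k - 1)) / S : ℝ) : ℂ) := by
      intro k hk
      have hp1 : 0 < p k - 1 := by linarith [hp k]
      simp only [z, mem_range.1 hk, if_true]
      by_cases hb : β k = 0
      · have : p k / (p k - 1) ≠ 0 := by linarith [hq k]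
        simp [hb, Real.zero_rpow this]
      · have hn : (‖β k‖ : ℂ) ≠ 0 := by simpa using hb
        have e : ‖β k‖ ^ (p k / (p k - 1)) = ‖β k‖ * ‖β k‖ ^ (p k / (p k - 1) - 1) := by
          rw [Real.rpow_sub_one (by simpa using hb)]
          field_simp [norm_ne_zero_iff.2 hb]
        rw [e, ← mul_assoc, ← mul_div_assoc, Complex.mul_conj']
        push_cast
        field_simp
    simp only
    rw [sum_congr rfl this, ← Complex.ofReal_sum, ← sum_div, ← hSd, div_self hS0.ne']
    simp

lemma real_bdd (f : ℕ → ℝ) (M : ℝ) (h : ∀ F : Finset ℕ, |∑ n ∈ F, f n| ≤ M) :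
    Summable fun n => |f n| := by
  refine summable_of_sum_le (c := 2 * M) (fun _ => abs_nonneg _) fun F => ?_
  rw [← sum_filter_add_sum_filter_not F (fun n => 0 ≤ f n)]
  have h1 : ∑ n ∈ F.filter (fun n => 0 ≤ f n), |f n| = ∑ n ∈ F.filter (fun n => 0 ≤ f n), f n :=
    sum_congr rfl fun n hn => abs_of_nonneg (mem_filter.1 hn).2
  have h2 : ∑ n ∈ F.filter (fun n => ¬ 0 ≤ f n), |f n|
      = -∑ n ∈ F.filter (fun n => ¬ 0 ≤ f n), f n := by
    rw [← sum_neg_distrib]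
    exact sum_congr rfl fun n hn => abs_of_neg (not_le.1 (mem_filter.1 hn).2)
  rw [h1, h2]
  have a := (abs_le.1 (h (F.filter (fun n => 0 ≤ f n)))).2
  have b := (abs_le.1 (h (F.filter (fun n => ¬ 0 ≤ f n)))).1
  linarith

lemma complex_bdd (f : ℕ → ℂ) (M : ℝ) (h : ∀ F : Finset ℕ, ‖∑ n ∈ F, f n‖ ≤ M) :
    Summable fun n => ‖f n‖ := by
  have h1 := real_bdd (fun n => (f n).re) M fun F => by
    rw [← Complex.re_sum]; exact (Complex.abs_re_le_norm _).trans (h F)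
  have h2 := real_bdd (fun n => (f n).im) M fun F => by
    rw [← Complex.im_sum]; exact (Complex.abs_im_le_norm _).trans (h F)
  exact Summable.of_nonneg_of_le (fun _ => norm_nonneg _)
    (fun n => Complex.norm_le_abs_re_add_abs_im (f n)) (h1.add h2)

lemma young (p H : ℝ) (hp : 1 < p) (hpH : p ≤ H) (L : ℕ) (hL : 1 ≤ L) (b x : ℂ) :
    ‖b * x‖ ≤ ‖b * (L : ℂ)⁻¹‖ ^ (p / (p - 1)) + (L : ℝ) ^ H * ‖x‖ ^ p := by
  have hL' : (1 : ℝ) ≤ L := by exact_mod_cast hL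
  have hL0 : (L : ℂ) ≠ 0 := by exact_mod_cast (by omega : L ≠ 0)
  have hc : (p / (p - 1)).HolderConjugate p := (Real.HolderConjugate.conjExponent hp).symm
  have h1 := Real.young_inequality_of_nonneg (norm_nonneg (b * (L : ℂ)⁻¹))
    (norm_nonneg ((L : ℂ) * x)) hc
  have e : ‖b * x‖ = ‖b * (L : ℂ)⁻¹‖ * ‖(L : ℂ) * x‖ := by
    rw [← norm_mul]; congr 1; field_simp
  rw [e]
  refine h1.trans (add_le_add (div_le_self (by positivity) hc.lt.le) ?_)
  refine (div_le_self (by positivity) hp.le).trans ?_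
  rw [norm_mul, Real.mul_rpow (norm_nonneg _) (norm_nonneg _), Complex.norm_natCast]
  gcongr

end GE

/-- Grosse-Erdmann's characterization: for `1 < p_k ≤ H < ∞`, `A ∈ (l(p), l_1)` iff
`sup_F Σ_k |Σ_{n∈F} a_{nk} L^{-1}|^{p_k'} < ∞` for some integer `L ≥ 1`. -/
theorem stmt7 (p : ℕ → ℝ) (H : ℝ) (hp : ∀ k, 1 < p k) (hpH : ∀ k, p k ≤ H)
    (A : ℕ → ℕ → ℂ) :
    ((∀ x : ℕ → ℂ, (Summable fun k => ‖x k‖ ^ p k) →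
      ∃ Ax : ℕ → ℂ,
        (∀ n, Tendsto (fun m => ∑ k ∈ Finset.range m, A n k * x k) atTop (nhds (Ax n))) ∧
        Summable fun n => ‖Ax n‖)
    ↔
    (∃ L : ℕ, 1 ≤ L ∧ ∃ C : ℝ,
      ∀ F : Finset ℕ, F.Nonempty →
        (Summable fun k => ‖(∑ n ∈ F, A n k) * ((L : ℂ))⁻¹‖ ^ (p k / (p k - 1))) ∧
        ∑' k, ‖(∑ n ∈ F, A n k) * ((L : ℂ))⁻¹‖ ^ (p k / (p k - 1)) ≤ C)) := by
  constructor
  · intro h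
    obtain ⟨T, hT, M, hM⟩ := GE.forward p H hp hpH A h
    obtain ⟨L, hL⟩ := exists_nat_gt (max M 1)
    have hL1 : (1 : ℝ) < L := (le_max_right _ _).trans_lt hL
    have hLM : M < L := (le_max_left _ _).trans_lt hL
    have hL0 : (L : ℂ) ≠ 0 := by
      have : (L : ℝ) ≠ 0 := by linarith
      exact_mod_cast this
    refine ⟨L, by exact_mod_cast hL1.le, 1, fun F _ => ?_⟩
    have main : ∀ m, ∑ k ∈ range m, ‖(∑ n ∈ F, A n k) * ((L : ℂ))⁻¹‖ ^ (p k / (p k - 1)) ≤ 1 := by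
      intro m
      by_contra hcon
      push Not at hcon
      obtain ⟨z, hz0, hz1⟩ := GE.test p hp _ m hcon
      have hTz : ∀ n, T n z = ∑ k ∈ range m, A n k * z.1 k := by
        intro n
        refine tendsto_nhds_unique (hT n z) (tendsto_const_nhds.congr' ?_)
        filter_upwards [eventually_ge_atTop m] with m' hm'
        refine sum_subset (range_mono hm') fun k _ hk => ?_
        rw [hz0 k (by simpa using hk), mul_zero]
      have h2 : ∑ n ∈ F, T n z = L := by
        simp_rw [hTz]
        rw [sum_comm]
        simp_rw [← sum_mul]
        rw [← mul_one (L : ℂ), ← hz1, mul_sum]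
        refine sum_congr rfl fun k _ => ?_
        field_simp
      have h3 := hM F z
      rw [h2, Complex.norm_natCast] at h3
      linarith
    have hs := summable_of_sum_range_le (fun k => by positivity) main
    exact ⟨hs, Real.tsum_le_of_sum_range_le (fun k => by positivity) main⟩
  · rintro ⟨L, hL, C, hC⟩ x hx
    have hbs : ∀ F : Finset ℕ, F.Nonempty → (Summable fun k => ‖(∑ n ∈ F, A n k) * x k‖) ∧
        ∑' k, ‖(∑ n ∈ F, A n k) * x k‖ ≤ C + (L : ℝ) ^ H * ∑' k, ‖x k‖ ^ p k := by
      intro F hF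
      obtain ⟨h1, h2⟩ := hC F hF
      have h3 := h1.add (hx.mul_left ((L : ℝ) ^ H))
      have hle := fun k => GE.young (p k) H (hp k) (hpH k) L hL (∑ n ∈ F, A n k) (x k)
      have h4 : Summable fun k => ‖(∑ n ∈ F, A n k) * x k‖ :=
        Summable.of_nonneg_of_le (fun _ => norm_nonneg _) hle h3
      refine ⟨h4, (h4.tsum_le_tsum hle h3).trans ?_⟩
      rw [h1.tsum_add (hx.mul_left ((L : ℝ) ^ H)), tsum_mul_left]
      linarith
    have hsn : ∀ n, Summable fun k => A n k * x k := fun n => by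
      have := (hbs {n} (singleton_nonempty n)).1
      simp only [sum_singleton] at this
      exact this.of_norm
    refine ⟨fun n => ∑' k, A n k * x k, fun n => (hsn n).hasSum.tendsto_sum_nat, ?_⟩
    refine GE.complex_bdd _ (max 0 (C + (L : ℝ) ^ H * ∑' k, ‖x k‖ ^ p k)) fun F => ?_
    rcases F.eq_empty_or_nonempty with rfl | hF
    · simp
    · rw [← Summable.tsum_finsetSum fun n _ => hsn n]
      simp_rw [← sum_mul]
      exact (norm_tsum_le_tsum_norm (hbs F hF).1).trans ((hbs F hF).2.trans (le_max_right _ _))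
end

section
/- Let 1 < p_k for all k with sup p_k < ∞. A sequence a = (a_n) belongs to the α-dual of l(r,s,t,p;B) if and only if there exists L ∈ ℕ such that sup_F Σ_k |Σ_{n∈F} c_{nk} L^{-1}|^{p_k'} < ∞, where c_{nk} = Σ_{j=k}^n (-1)^{j-k} ((-v)^{n-j}/u^{n-j+1}) (D^{(s)}_{j-k}/t_j) r_k a_n for 0 ≤ k ≤ n and c_{nk} = 0 for k > n, and the supremum runs over nonempty finite subsets F of ℕ₀. -/
open Filter Finset Topology

/-- The `A(r,s,t;B)`-transform: `(A(r,s,t)·B(u,v) x)_n`. -/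
noncomputable def GmB (r s t : ℕ → ℂ) (u v : ℂ) (x : ℕ → ℂ) (n : ℕ) : ℂ :=
  (r n)⁻¹ * ((∑ k ∈ Finset.range n, (s (n - k) * t k * u + s (n - k - 1) * t (k + 1) * v) * x k)
    + s 0 * t n * u * x n)

/-- The matrix `C`: `c_{nk} = Σ_{j=k}^n (-1)^{j-k} ((-v)^{n-j}/u^{n-j+1}) (D^{(s)}_{j-k}/t_j) r_k a_n`
for `0 ≤ k ≤ n`, `0` otherwise. -/
noncomputable def Cmat (r t : ℕ → ℂ) (u v : ℂ) (D : ℕ → ℂ) (a : ℕ → ℂ) (n k : ℕ) : ℂ :=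
  if k ≤ n then
    (∑ j ∈ Finset.Icc k n,
      (-1 : ℂ) ^ (j - k) * ((-v) ^ (n - j) / u ^ (n - j + 1)) * (D (j - k) / t j)) * r k * a n
  else 0

/-- forward substitution: the intermediate sequence `z = B x`. -/
noncomputable def zSeq (r t D y : ℕ → ℂ) (j : ℕ) : ℂ :=
  (t j)⁻¹ * ∑ k ∈ Finset.range (j + 1), (-1 : ℂ) ^ (j - k) * D (j - k) * (r k * y k)

/-- the inverse transform. -/
noncomputable def xSeq (r t D : ℕ → ℂ) (u v : ℂ) (y : ℕ → ℂ) (n : ℕ) : ℂ :=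
  ∑ j ∈ Finset.range (n + 1), ((-v) ^ (n - j) / u ^ (n - j + 1)) * zSeq r t D y j

lemma xSeq_zero (r t D : ℕ → ℂ) (u v : ℂ) (hu : u ≠ 0) (y : ℕ → ℂ) :
    u * xSeq r t D u v y 0 = zSeq r t D y 0 := by
  simp [xSeq]; field_simp

lemma xSeq_succ (r t D : ℕ → ℂ) (u v : ℂ) (hu : u ≠ 0) (y : ℕ → ℂ) (n : ℕ) :
    u * xSeq r t D u v y (n + 1) + v * xSeq r t D u v y n = zSeq r t D y (n + 1) := by
  unfold xSeq
  rw [Finset.sum_range_succ, mul_add]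
  have h : u * ∑ j ∈ Finset.range (n + 1), ((-v) ^ (n + 1 - j) / u ^ (n + 1 - j + 1)) * zSeq r t D y j
      = - (v * ∑ j ∈ Finset.range (n + 1), ((-v) ^ (n - j) / u ^ (n - j + 1)) * zSeq r t D y j) := by
    rw [Finset.mul_sum, Finset.mul_sum, ← Finset.sum_neg_distrib]
    refine Finset.sum_congr rfl fun j hj => ?_
    have : n + 1 - j = (n - j) + 1 := by have := Finset.mem_range.1 hj; omega
    rw [this]
    field_simp
    ring
  rw [h]
  simp
  field_simp

lemma conv_inv (s D w : ℕ → ℂ)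
    (hD : ∀ n, ∑ k ∈ Finset.range (n + 1), (-1 : ℂ) ^ k * D k * s (n - k) =
      if n = 0 then 1 else 0) (n : ℕ) :
    ∑ k ∈ Finset.range (n + 1), s (n - k) *
      (∑ i ∈ Finset.range (k + 1), (-1 : ℂ) ^ (k - i) * D (k - i) * w i) = w n := by
  have h1 : PowerSeries.mk (fun k => (-1 : ℂ) ^ k * D k) * PowerSeries.mk s = 1 := by
    ext m
    rw [PowerSeries.coeff_mul, Finset.Nat.sum_antidiagonal_eq_sum_range_succ_mk, PowerSeries.coeff_one]
    simpa using hD m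
  have h2 : (PowerSeries.mk w * PowerSeries.mk (fun k => (-1 : ℂ) ^ k * D k)) * PowerSeries.mk s
      = PowerSeries.mk w := by rw [mul_assoc, h1, mul_one]
  have h3 := congrArg (PowerSeries.coeff n) h2
  rw [PowerSeries.coeff_mul, Finset.Nat.sum_antidiagonal_eq_sum_range_succ_mk, PowerSeries.coeff_mk] at h3
  rw [← h3]
  refine Finset.sum_congr rfl fun k _ => ?_
  rw [PowerSeries.coeff_mul, Finset.Nat.sum_antidiagonal_eq_sum_range_succ_mk]
  simp only [PowerSeries.coeff_mk]
  rw [mul_comm]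
  congr 1
  exact Finset.sum_congr rfl fun i _ => by ring

lemma GmB_eq (r s t : ℕ → ℂ) (u v : ℂ) (x z : ℕ → ℂ) (h0 : u * x 0 = z 0)
    (h1 : ∀ n, u * x (n + 1) + v * x n = z (n + 1)) (n : ℕ) :
    GmB r s t u v x n = (r n)⁻¹ * ∑ k ∈ Finset.range (n + 1), s (n - k) * (t k * z k) := by
  unfold GmB
  congr 1
  have e1 : ∑ k ∈ Finset.range (n + 1), s (n - k) * (t k * z k)
     = ∑ k ∈ Finset.range (n + 1), s (n - k) * t k * u * x k
      + ∑ k ∈ Finset.range n, s (n - k - 1) * t (k + 1) * v * x k := by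
    rw [Finset.sum_range_succ', Finset.sum_range_succ' (fun k => s (n - k) * t k * u * x k), ← h0]
    simp_rw [← h1, Nat.sub_sub]
    rw [add_right_comm, ← Finset.sum_add_distrib]
    congr 1
    · exact Finset.sum_congr rfl fun i _ => by ring
    · ring
  rw [e1, Finset.sum_range_succ, add_right_comm, ← Finset.sum_add_distrib]
  simp only [Nat.sub_self]
  congr 1
  exact Finset.sum_congr rfl fun i _ => by ring

lemma GmB_xSeq (r s t : ℕ → ℂ) (u v : ℂ) (D : ℕ → ℂ)
    (hr : ∀ n, r n ≠ 0) (ht : ∀ n, t n ≠ 0) (hu : u ≠ 0)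
    (hD : ∀ n, ∑ k ∈ Finset.range (n + 1), (-1 : ℂ) ^ k * D k * s (n - k) =
      if n = 0 then 1 else 0) (y : ℕ → ℂ) (n : ℕ) :
    GmB r s t u v (xSeq r t D u v y) n = y n := by
  rw [GmB_eq r s t u v _ (zSeq r t D y) (xSeq_zero r t D u v hu y) (xSeq_succ r t D u v hu y)]
  have : ∀ k, t k * zSeq r t D y k =
      ∑ i ∈ Finset.range (k + 1), (-1 : ℂ) ^ (k - i) * D (k - i) * (r i * y i) := by
    intro k
    unfold zSeq
    rw [← mul_assoc, mul_inv_cancel₀ (ht k), one_mul]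
  simp_rw [this]
  rw [conv_inv s D (fun i => r i * y i) hD n, ← mul_assoc, inv_mul_cancel₀ (hr n), one_mul]

lemma GmB_inj (r s t : ℕ → ℂ) (u v : ℂ)
    (hr : ∀ n, r n ≠ 0) (ht : ∀ n, t n ≠ 0) (hs : s 0 ≠ 0) (hu : u ≠ 0) (x x' : ℕ → ℂ)
    (h : ∀ n, GmB r s t u v x n = GmB r s t u v x' n) (n : ℕ) : x n = x' n := by
  induction n using Nat.strong_induction_on with
  | _ n ih =>
    have h' := mul_left_cancel₀ (inv_ne_zero (hr n)) (h n)
    rw [Finset.sum_congr rfl fun k hk => by rw [ih k (Finset.mem_range.1 hk)]] at h'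
    exact mul_left_cancel₀ (mul_ne_zero (mul_ne_zero hs (ht n)) hu) (add_left_cancel h')

lemma a_mul_xSeq (r t : ℕ → ℂ) (u v : ℂ) (D a y : ℕ → ℂ) (n N : ℕ) (hN : n < N) :
    a n * xSeq r t D u v y n = ∑ k ∈ Finset.range N, Cmat r t u v D a n k * y k := by
  have e : ∑ k ∈ Finset.range N, Cmat r t u v D a n k * y k
      = ∑ k ∈ Finset.range (n + 1), Cmat r t u v D a n k * y k := by
    symm
    apply Finset.sum_subset
    · intro k; simp; omega
    · intro k _ hk
      have : ¬ k ≤ n := by simpa using hk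
      simp [Cmat, this]
  rw [e]
  unfold xSeq zSeq
  rw [Finset.mul_sum]
  have e2 : ∀ k ∈ Finset.range (n + 1), Cmat r t u v D a n k * y k =
     ∑ j ∈ Finset.Ico k (n + 1), (-1 : ℂ) ^ (j - k) * ((-v) ^ (n - j) / u ^ (n - j + 1)) * (D (j - k) / t j) * r k * a n * y k := by
    intro k hk
    have : k ≤ n := by have := Finset.mem_range.1 hk; omega
    simp only [Cmat, this, if_true, Finset.sum_mul]
    rfl
  rw [Finset.sum_congr rfl e2, Finset.range_eq_Ico]
  rw [Finset.sum_Ico_Ico_comm]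
  refine Finset.sum_congr rfl fun j _ => ?_
  rw [Finset.mul_sum, Finset.mul_sum, Finset.mul_sum]
  rw [Finset.range_eq_Ico]
  refine Finset.sum_congr rfl fun k _ => ?_
  ring

lemma summable_of_bdd_real (f : ℕ → ℝ) (K : ℝ) (h : ∀ F : Finset ℕ, |∑ n ∈ F, f n| ≤ K) :
    Summable fun n => |f n| := by
  refine summable_of_sum_le (c := K + K) (fun n => abs_nonneg _) fun F => ?_
  rw [← Finset.sum_filter_add_sum_filter_not F (fun n => 0 ≤ f n)]
  apply add_le_add
  · rw [Finset.sum_congr rfl (g := f) fun n hn => abs_of_nonneg (Finset.mem_filter.1 hn).2]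
    exact (le_abs_self _).trans (h _)
  · rw [Finset.sum_congr rfl (g := fun n => - f n) fun n hn =>
      abs_of_neg (not_le.1 (Finset.mem_filter.1 hn).2), Finset.sum_neg_distrib]
    exact (neg_le_abs _).trans (h _)

lemma summable_of_bdd (f : ℕ → ℂ) (K : ℝ) (h : ∀ F : Finset ℕ, ‖∑ n ∈ F, f n‖ ≤ K) :
    Summable fun n => ‖f n‖ := by
  have h1 := summable_of_bdd_real (fun n => (f n).re) K fun F => by
    rw [← Complex.re_sum]; exact (Complex.abs_re_le_norm _).trans (h F)
  have h2 := summable_of_bdd_real (fun n => (f n).im) K fun F => by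
    rw [← Complex.im_sum]; exact (Complex.abs_im_le_norm _).trans (h F)
  exact Summable.of_nonneg_of_le (fun n => norm_nonneg _)
    (fun n => Complex.norm_le_abs_re_add_abs_im _) (h1.add h2)

lemma jensen_aux {ι : Type*} (s : Finset ι) {p : ℝ} (hp : 1 < p) (w f : ι → ℝ)
    (hw : ∀ i, 0 ≤ w i) (hf : ∀ i, 0 ≤ f i) :
    (∑ i ∈ s, w i * f i) ^ p ≤ (∑ i ∈ s, w i) ^ (p - 1) * ∑ i ∈ s, w i * f i ^ p := by
  have h := Real.inner_le_weight_mul_Lp_of_nonneg s hp.le w f hw hf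
  have hW : 0 ≤ ∑ i ∈ s, w i := Finset.sum_nonneg fun i _ => hw i
  have hS : 0 ≤ ∑ i ∈ s, w i * f i ^ p :=
    Finset.sum_nonneg fun i _ => mul_nonneg (hw i) (Real.rpow_nonneg (hf i) _)
  have hp0 : p ≠ 0 := by linarith
  calc (∑ i ∈ s, w i * f i) ^ p
      ≤ ((∑ i ∈ s, w i) ^ (1 - p⁻¹) * (∑ i ∈ s, w i * f i ^ p) ^ p⁻¹) ^ p :=
        Real.rpow_le_rpow (Finset.sum_nonneg fun i _ => mul_nonneg (hw i) (hf i)) h (by linarith)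
    _ = _ := by
        rw [Real.mul_rpow (Real.rpow_nonneg hW _) (Real.rpow_nonneg hS _), ← Real.rpow_mul hW,
          ← Real.rpow_mul hS, inv_mul_cancel₀ hp0, Real.rpow_one, sub_mul, inv_mul_cancel₀ hp0, one_mul]

/-- the unit ball of the modular -/
abbrev MBall (p : ℕ → ℝ) : Type := {y : ℕ → ℂ // ∀ S : Finset ℕ, ∑ k ∈ S, ‖y k‖ ^ p k ≤ 1}

lemma MBall.le_one {p : ℕ → ℝ} (hp : ∀ k, 1 < p k) (y : MBall p) (k : ℕ) : ‖y.1 k‖ ≤ 1 := by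
  by_contra hc
  have h1 := y.2 {k}
  rw [Finset.sum_singleton] at h1
  have := Real.one_lt_rpow (not_le.1 hc) (by linarith [hp k] : 0 < p k)
  linarith

lemma l1_summable {ι : Type*} (α : lp (fun _ : ι => ℂ) 1) : Summable fun i => ‖α i‖ := by
  simpa using (lp.memℓp α).summable (by simp)

lemma l1_norm {ι : Type*} (α : lp (fun _ : ι => ℂ) 1) : ‖α‖ = ∑' i, ‖α i‖ := by
  simpa using lp.norm_eq_tsum_rpow (p := 1) (by simp) α

lemma l1_mul_summable {p : ℕ → ℝ} (hp : ∀ k, 1 < p k) (α : lp (fun _ : MBall p => ℂ) 1) (k : ℕ) :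
    Summable fun i : MBall p => α i * i.1 k := by
  refine Summable.of_norm_bounded (l1_summable α) fun i => ?_
  rw [norm_mul]
  exact mul_le_of_le_one_right (norm_nonneg _) (i.le_one hp k)

/-- evaluation of the synthesis operator at coordinate `k` -/
noncomputable def evT {p : ℕ → ℝ} (hp : ∀ k, 1 < p k) (k : ℕ) :
    lp (fun _ : MBall p => ℂ) 1 →L[ℂ] ℂ :=
  LinearMap.mkContinuous
    { toFun := fun α => ∑' i : MBall p, α i * i.1 k
      map_add' := fun α β => by
        rw [← (l1_mul_summable hp α k).tsum_add (l1_mul_summable hp β k)]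
        exact tsum_congr fun i => by simp [add_mul]
      map_smul' := fun c α => by
        simp only [RingHom.id_apply, smul_eq_mul]
        rw [← tsum_mul_left]
        exact tsum_congr fun i => by simp [mul_assoc] } 1
    (fun α => by
      rw [one_mul, l1_norm]
      refine tsum_of_norm_bounded (l1_summable α).hasSum fun i => ?_
      rw [norm_mul]
      exact mul_le_of_le_one_right (norm_nonneg _) (i.le_one hp k))

lemma evT_apply {p : ℕ → ℝ} (hp : ∀ k, 1 < p k) (k : ℕ) (α : lp (fun _ : MBall p => ℂ) 1) :
    evT hp k α = ∑' i : MBall p, α i * i.1 k := rfl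

lemma evT_single {p : ℕ → ℝ} (hp : ∀ k, 1 < p k) (k : ℕ) (y : MBall p) [DecidableEq (MBall p)] :
    evT hp k (lp.single 1 y 1) = y.1 k := by
  rw [evT_apply, tsum_eq_single y]
  · simp
  · intro i hi
    have h0 := lp.single_apply_ne (E := fun _ : MBall p => ℂ) 1 y (1 : ℂ) hi
    exact mul_eq_zero_of_left h0 _

lemma evT_modular {p : ℕ → ℝ} {H : ℝ} (hp : ∀ k, 1 < p k) (hpH : ∀ k, p k ≤ H)
    (α : lp (fun _ : MBall p => ℂ) 1) : Summable fun k => ‖evT hp k α‖ ^ p k := by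
  set M : ℝ := max 1 ‖α‖ with hM
  have hM1 : 1 ≤ M := le_max_left _ _
  refine summable_of_sum_le (c := M ^ H * M) (fun k => Real.rpow_nonneg (norm_nonneg _) _) fun S => ?_
  have htend : Tendsto (fun s : Finset (MBall p) => ∑ k ∈ S, ‖∑ i ∈ s, α i * i.1 k‖ ^ p k) atTop
      (𝓝 (∑ k ∈ S, ‖evT hp k α‖ ^ p k)) := by
    refine tendsto_finsetSum _ fun k _ => ?_
    exact ((l1_mul_summable hp α k).hasSum.norm).rpow_const (Or.inr (by linarith [hp k]))
  refine le_of_tendsto' htend fun s => ?_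
  have hW : ∑ i ∈ s, ‖α i‖ ≤ M := by
    refine le_trans ?_ (le_max_right _ _)
    rw [l1_norm]
    exact (l1_summable α).sum_le_tsum s fun i _ => norm_nonneg _
  have hMH : 0 ≤ M ^ H := by positivity
  calc ∑ k ∈ S, ‖∑ i ∈ s, α i * i.1 k‖ ^ p k
      ≤ ∑ k ∈ S, M ^ H * ∑ i ∈ s, ‖α i‖ * ‖i.1 k‖ ^ p k := by
        refine Finset.sum_le_sum fun k _ => ?_
        have hk := hp k
        calc ‖∑ i ∈ s, α i * i.1 k‖ ^ p k ≤ (∑ i ∈ s, ‖α i‖ * ‖i.1 k‖) ^ p k := by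
              refine Real.rpow_le_rpow (norm_nonneg _) ?_ (by linarith)
              refine (norm_sum_le _ _).trans (le_of_eq ?_)
              simp
          _ ≤ _ := jensen_aux s hk (fun i => ‖α i‖) (fun i => ‖i.1 k‖) (fun _ => norm_nonneg _)
                (fun _ => norm_nonneg _)
          _ ≤ _ := by
              refine mul_le_mul_of_nonneg_right ?_ (Finset.sum_nonneg fun i _ => by positivity)
              calc _ ≤ M ^ (p k - 1) := Real.rpow_le_rpow (Finset.sum_nonneg fun i _ => norm_nonneg _) hW (by linarith)
                _ ≤ M ^ H := Real.rpow_le_rpow_of_exponent_le hM1 (by linarith [hpH k])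
    _ = M ^ H * ∑ i ∈ s, ‖α i‖ * ∑ k ∈ S, ‖i.1 k‖ ^ p k := by
        rw [← Finset.mul_sum, Finset.sum_comm]
        simp_rw [Finset.mul_sum]
    _ ≤ M ^ H * M := by
        refine mul_le_mul_of_nonneg_left (le_trans ?_ hW) hMH
        exact Finset.sum_le_sum fun i _ => mul_le_of_le_one_right (norm_nonneg _) (i.2 S)

lemma unif_bdd {p : ℕ → ℝ} {H : ℝ} (hp : ∀ k, 1 < p k) (hpH : ∀ k, p k ≤ H) {J : Type*}
    (c : J → ℕ → ℂ) (N : J → ℕ)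
    (h : ∀ y : ℕ → ℂ, (Summable fun k => ‖y k‖ ^ p k) →
      ∃ K : ℝ, ∀ F, ‖∑ k ∈ Finset.range (N F), c F k * y k‖ ≤ K) :
    ∃ K : ℝ, ∀ F, ∀ y : MBall p, ‖∑ k ∈ Finset.range (N F), c F k * y.1 k‖ ≤ K := by
  classical
  let g : J → lp (fun _ : MBall p => ℂ) 1 →L[ℂ] ℂ := fun F =>
    ∑ k ∈ Finset.range (N F), c F k • evT hp k
  have hg : ∀ F α, g F α = ∑ k ∈ Finset.range (N F), c F k * evT hp k α := by
    intro F α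
    simp [g]
  obtain ⟨K, hK⟩ := banach_steinhaus (g := g) (fun α => by
    obtain ⟨K, hK⟩ := h (fun k => evT hp k α) (evT_modular hp hpH α)
    exact ⟨K, fun F => by rw [hg]; exact hK F⟩)
  refine ⟨K, fun F y => ?_⟩
  have h1 := (g F).le_opNorm (lp.single 1 y 1)
  rw [hg, lp.norm_single (by simp)] at h1
  simp_rw [evT_single] at h1
  calc _ ≤ _ := h1
    _ ≤ K := by simpa using hK F

lemma rev_holder {p : ℕ → ℝ} (hp : ∀ k, 1 < p k) (b : ℕ → ℂ) (N : ℕ) (K : ℝ)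
    (h : ∀ y : MBall p, ‖∑ k ∈ Finset.range N, b k * y.1 k‖ ≤ K) (L : ℝ) (hL : 0 < L) (hKL : K < L) :
    ∑ k ∈ Finset.range N, (‖b k‖ / L) ^ (p k / (p k - 1)) ≤ 1 := by
  set S := ∑ k ∈ Finset.range N, (‖b k‖ / L) ^ (p k / (p k - 1)) with hS
  by_contra hc
  have hS1 : 1 < S := not_le.1 hc
  have hS0 : 0 < S := by linarith
  -- phase
  let y : ℕ → ℂ := fun k => if k < N then
    ((S⁻¹ : ℝ) : ℂ) * (((‖b k‖ / L) ^ (1 / (p k - 1)) : ℝ) : ℂ) * (starRingEnd ℂ (b k) / (‖b k‖ : ℂ)) else 0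
  have hyn : ∀ k, ‖y k‖ ^ p k ≤ if k < N then S⁻¹ * (‖b k‖ / L) ^ (p k / (p k - 1)) else 0 := by
    intro k
    have hk := hp k
    by_cases hkN : k < N
    · simp only [y, hkN, if_true]
      have h0 : 0 ≤ ‖b k‖ / L := by positivity
      have : ‖((S⁻¹ : ℝ) : ℂ) * (((‖b k‖ / L) ^ (1 / (p k - 1)) : ℝ) : ℂ) * (starRingEnd ℂ (b k) / (‖b k‖ : ℂ))‖
          ≤ S⁻¹ * (‖b k‖ / L) ^ (1 / (p k - 1)) := by
        rw [norm_mul, norm_mul, Complex.norm_real, Complex.norm_real, norm_div, Complex.norm_real,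
          RCLike.norm_conj, norm_norm, Real.norm_of_nonneg (by positivity : 0 ≤ S⁻¹),
          Real.norm_of_nonneg (Real.rpow_nonneg h0 _)]
        exact mul_le_of_le_one_right (by positivity) (div_self_le_one _)
      refine (Real.rpow_le_rpow (norm_nonneg _) this (by linarith)).trans ?_
      rw [Real.mul_rpow (by positivity) (by positivity), ← Real.rpow_mul h0, one_div_mul_eq_div]
      refine mul_le_mul_of_nonneg_right ?_ (by positivity)
      exact Real.rpow_le_self_of_le_one (by positivity) (inv_le_one_of_one_le₀ hS1.le) hk.le
    · simp only [y, hkN, if_false]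
      simp [Real.zero_rpow (by linarith : p k ≠ 0)]
  have hyB : ∀ T : Finset ℕ, ∑ k ∈ T, ‖y k‖ ^ p k ≤ 1 := by
    intro T
    calc _ ≤ ∑ k ∈ T, if k < N then S⁻¹ * (‖b k‖ / L) ^ (p k / (p k - 1)) else 0 :=
          Finset.sum_le_sum fun k _ => hyn k
      _ = ∑ k ∈ T.filter (· < N), S⁻¹ * (‖b k‖ / L) ^ (p k / (p k - 1)) := by
          rw [Finset.sum_filter]
      _ ≤ ∑ k ∈ Finset.range N, S⁻¹ * (‖b k‖ / L) ^ (p k / (p k - 1)) := by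
          refine Finset.sum_le_sum_of_subset_of_nonneg ?_ fun k _ _ => by positivity
          intro k hk
          simpa using (Finset.mem_filter.1 hk).2
      _ = 1 := by rw [← Finset.mul_sum, ← hS, inv_mul_cancel₀ hS0.ne']
  have key : ∑ k ∈ Finset.range N, b k * y k = ((L : ℝ) : ℂ) := by
    have : ∀ k ∈ Finset.range N, b k * y k =
        ((S⁻¹ * (L * (‖b k‖ / L) ^ (p k / (p k - 1))) : ℝ) : ℂ) := by
      intro k hk
      have hk' := hp k
      have hpk : p k - 1 ≠ 0 := by linarith
      simp only [y, Finset.mem_range.1 hk, if_true]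
      by_cases hb : b k = 0
      · have : p k / (p k - 1) ≠ 0 := div_ne_zero (by linarith) hpk
        simp [hb, Real.zero_rpow this]
      · have hbn : 0 < ‖b k‖ := norm_pos_iff.2 hb
        have hbc : (‖b k‖ : ℂ) ≠ 0 := by exact_mod_cast hbn.ne'
        have e1 : b k * (starRingEnd ℂ (b k) / (‖b k‖ : ℂ)) = (‖b k‖ : ℂ) := by
          rw [← mul_div_assoc, Complex.mul_conj', sq, mul_div_assoc, div_self hbc, mul_one]
        have e2 : L * (‖b k‖ / L) ^ (p k / (p k - 1)) = ‖b k‖ * (‖b k‖ / L) ^ (1 / (p k - 1)) := by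
          have : p k / (p k - 1) = 1 + 1 / (p k - 1) := by field_simp; ring
          rw [this, Real.rpow_add (by positivity), Real.rpow_one]
          field_simp
        rw [e2]
        push_cast
        rw [← e1]
        simp only [e1]
        linear_combination ((S : ℂ)⁻¹ * (((‖b k‖ / L) ^ (1 / (p k - 1)) : ℝ) : ℂ)) * e1
    rw [Finset.sum_congr rfl this, ← Complex.ofReal_sum, ← Finset.mul_sum, ← Finset.mul_sum, ← hS]
    congr 1
    field_simp
  have := h ⟨y, hyB⟩
  simp only [key, Complex.norm_real, Real.norm_of_nonneg hL.le] at this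
  linarith

/-- the finite sums of `a x` through the matrix `C`. -/
lemma sum_a_xSeq (r t : ℕ → ℂ) (u v : ℂ) (D a y : ℕ → ℂ) (F : Finset ℕ) :
    ∑ n ∈ F, a n * xSeq r t D u v y n =
      ∑ k ∈ Finset.range (F.sup id + 1), (∑ n ∈ F, Cmat r t u v D a n k) * y k := by
  simp_rw [Finset.sum_mul]
  rw [Finset.sum_comm]
  refine Finset.sum_congr rfl fun n hn => ?_
  exact a_mul_xSeq r t u v D a y n _ (Nat.lt_succ_of_le (Finset.le_sup (f := id) hn))

lemma tsum_C (r t : ℕ → ℂ) (u v : ℂ) (D a : ℕ → ℂ) (p : ℕ → ℝ) (hp : ∀ k, 1 < p k)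
    (F : Finset ℕ) (L : ℕ) :
    ∑' k, ‖(∑ n ∈ F, Cmat r t u v D a n k) * ((L : ℂ))⁻¹‖ ^ (p k / (p k - 1)) =
      ∑ k ∈ Finset.range (F.sup id + 1),
        (‖∑ n ∈ F, Cmat r t u v D a n k‖ / (L : ℝ)) ^ (p k / (p k - 1)) := by
  rw [tsum_eq_sum (s := Finset.range (F.sup id + 1))]
  · refine Finset.sum_congr rfl fun k _ => ?_
    rw [norm_mul, norm_inv, Complex.norm_natCast, ← div_eq_mul_inv]
  · intro k hk
    have h0 : ∑ n ∈ F, Cmat r t u v D a n k = 0 := by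
      refine Finset.sum_eq_zero fun n hn => ?_
      have h1 : n ≤ F.sup id := Finset.le_sup (f := id) hn
      have h2 : ¬ k < F.sup id + 1 := by simpa using hk
      have : ¬ k ≤ n := by omega
      simp [Cmat, this]
    have hk := hp k
    have : p k / (p k - 1) ≠ 0 := div_ne_zero (by linarith) (by linarith)
    simp [h0, Real.zero_rpow this]

/-- α-dual of `l(r,s,t,p;B)` for `1 < p_k ≤ H`: `a ∈ [l(r,s,t,p;B)]^α` iff there is `L ∈ ℕ`
with `sup_F Σ_k |Σ_{n∈F} c_{nk} L^{-1}|^{p_k'} < ∞`. -/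
theorem stmt9 (r s t : ℕ → ℂ) (u v : ℂ) (D : ℕ → ℂ) (p : ℕ → ℝ) (H : ℝ)
    (hp : ∀ k, 1 < p k) (hpH : ∀ k, p k ≤ H)
    (hr : ∀ n, r n ≠ 0) (ht : ∀ n, t n ≠ 0) (hs : s 0 ≠ 0) (hu : u ≠ 0) (hv : v ≠ 0)
    (hD : ∀ n, ∑ k ∈ Finset.range (n + 1), (-1 : ℂ) ^ k * D k * s (n - k) =
      if n = 0 then 1 else 0)
    (a : ℕ → ℂ) :
    ((∀ x : ℕ → ℂ, (Summable fun n => ‖GmB r s t u v x n‖ ^ p n) →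
      Summable fun n => ‖a n * x n‖)
    ↔
    (∃ L : ℕ, 1 ≤ L ∧ ∃ C : ℝ,
      ∀ F : Finset ℕ, F.Nonempty →
        ∑' k, ‖(∑ n ∈ F, Cmat r t u v D a n k) * ((L : ℂ))⁻¹‖ ^ (p k / (p k - 1)) ≤ C)) := by
  have hinv : ∀ x n, x n = xSeq r t D u v (GmB r s t u v x) n := fun x n =>
    GmB_inj r s t u v hr ht hs hu x _
      (fun m => (GmB_xSeq r s t u v D hr ht hu hD (GmB r s t u v x) m).symm) n
  simp_rw [tsum_C r t u v D a p hp]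
  constructor
  · intro h
    obtain ⟨K, hK⟩ := unif_bdd hp hpH (fun (F : Finset ℕ) k => ∑ n ∈ F, Cmat r t u v D a n k)
      (fun F => F.sup id + 1) (fun y hy => by
        have hx := h (xSeq r t D u v y) (by
          simpa only [GmB_xSeq r s t u v D hr ht hu hD y] using hy)
        refine ⟨∑' n, ‖a n * xSeq r t D u v y n‖, fun F => ?_⟩
        rw [← sum_a_xSeq]
        exact (norm_sum_le _ _).trans (hx.sum_le_tsum F fun i _ => norm_nonneg _))
    obtain ⟨L, hL⟩ := exists_nat_gt (max K 0)
    have hL0 : (0 : ℝ) < L := (le_max_right _ _).trans_lt hL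
    refine ⟨L, by exact_mod_cast hL0, 1, fun F _ => ?_⟩
    exact rev_holder hp _ _ K (hK F) L hL0 ((le_max_left _ _).trans_lt hL)
  · rintro ⟨L, hL1, C, hC⟩ x hx
    have hL : (1 : ℝ) ≤ L := by exact_mod_cast hL1
    have hL0 : (0 : ℝ) < L := by linarith
    set y := GmB r s t u v x with hy
    have hC0 : 0 ≤ C := le_trans (Finset.sum_nonneg fun k _ => by positivity) (hC {0} (by simp))
    refine summable_of_bdd (fun n => a n * x n) (C + (L : ℝ) ^ H * ∑' k, ‖y k‖ ^ p k) fun F => ?_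
    have hY : 0 ≤ ∑' k, ‖y k‖ ^ p k := tsum_nonneg fun k => by positivity
    rcases F.eq_empty_or_nonempty with rfl | hF
    · simp; positivity
    have e : ∑ n ∈ F, a n * x n = ∑ n ∈ F, a n * xSeq r t D u v y n :=
      Finset.sum_congr rfl fun n _ => by rw [← hinv x n]
    rw [e, sum_a_xSeq]
    refine (norm_sum_le _ _).trans ?_
    calc _ ≤ ∑ k ∈ Finset.range (F.sup id + 1),
          ((‖∑ n ∈ F, Cmat r t u v D a n k‖ / (L : ℝ)) ^ (p k / (p k - 1))
            + (L : ℝ) ^ H * ‖y k‖ ^ p k) := by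
          refine Finset.sum_le_sum fun k _ => ?_
          have hk := hp k
          set b := ∑ n ∈ F, Cmat r t u v D a n k
          have hc : (p k).HolderConjugate (p k / (p k - 1)) := Real.HolderConjugate.conjExponent hk
          have hyo := Real.young_inequality_of_nonneg (a := ‖b‖ / L) (b := L * ‖y k‖)
            (by positivity) (by positivity) hc.symm
          have e1 : ‖b * y k‖ = ‖b‖ / L * (L * ‖y k‖) := by
            rw [norm_mul]; field_simp
          rw [e1]
          refine hyo.trans (add_le_add ?_ ?_)
          · exact div_le_self (by positivity) hc.symm.lt.le
          · refine (div_le_self (by positivity) hk.le).trans ?_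
            rw [Real.mul_rpow hL0.le (norm_nonneg _)]
            exact mul_le_mul_of_nonneg_right
              (Real.rpow_le_rpow_of_exponent_le hL (hpH k)) (by positivity)
      _ ≤ _ := by
          rw [Finset.sum_add_distrib, ← Finset.mul_sum]
          refine add_le_add (hC F hF) (mul_le_mul_of_nonneg_left ?_ (by positivity))
          exact hx.sum_le_tsum _ fun k _ => by positivity
end
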